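/- (Lemmas 3 and A4, refined variance estimator.) Under Assumptions 1, 2 and 3, with V*_{X̂} := Σ_{g∈𝒢} p_g^{-1} A_{0,g} S*_g A_{0,g}′ positive definite, suppose there exists g_min ∈ 𝒢 ∩ {2,…,T} with A_{θ,g} = 0 for every g ∈ 𝒢 with g < g_min; let M select the coordinates t < g_min, assume M S*_{g_min} M′ is invertible, set β̂_g := (M Ŝ_g M′)^{-1} M Ŝ_g A_{θ,g}′ for g ≥ g_min, and define the refined estimator σ̂**² := σ̂*² − (Σ_{g≥g_min} β̂_g)′ (M Ŝ_{g_min} M′) (Σ_{g≥g_min} β̂_g). Then σ̂**² converges in probability to σ*² + S*_{θ̃}, where S*_{θ̃} := S*_θ − (Σ_{g≥g_min} β*_g)′ (M S*_{g_min} M′) (Σ_{g≥g_min} β*_g) with β*_g := (M S*_g M′)^{-1} M S*_g A_{θ,g}′, and 0 ≤ S*_{θ̃} ≤ S*_θ, so that σ̂** is asymptotically weakly less conservative than the Neyman-style estimator σ̂*. -/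

import Mathlib

open Finset Filter Topology Matrix MeasureTheory ProbabilityTheory
open scoped BigOperators Classical ENNReal NNReal

noncomputable section

namespace Staggered

/-- Treatment dates: `ℕ∞ = ℕ ∪ {∞}`; `⊤` means never treated. -/
abbrev Date : Type := ℕ∞

/-- Period `t : Fin T` stands for calendar period `t + 1`; `periodLT t g` says that period `t`
is strictly earlier than the treatment date `g` (i.e. `g > t`). -/
def periodLT {T : ℕ} (t : Fin T) (g : Date) : Prop := (((t : ℕ) + 1 : ℕ) : Date) < g

/-- Assumption 1 sample space: the valid assignment vectors, i.e. those in which exactly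
`Ng g` units have first-treatment date `g`, for every `g ∈ 𝒢`. -/
def assigns (N : ℕ) (𝒢 : Finset Date) (Ng : Date → ℕ) : Finset (Fin N → 𝒢) :=
  Finset.univ.filter fun d => ∀ g ∈ 𝒢, (Finset.univ.filter fun i => (d i : Date) = g).card = Ng g

/-- Expectation under the uniform distribution on valid assignments (Assumption 1). -/
def expec (N : ℕ) (𝒢 : Finset Date) (Ng : Date → ℕ) (f : (Fin N → 𝒢) → ℝ) : ℝ :=
  (∑ d ∈ assigns N 𝒢 Ng, f d) / ((assigns N 𝒢 Ng).card : ℝ)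

/-- Probability of an event under the uniform distribution on valid assignments. -/
def prob (N : ℕ) (𝒢 : Finset Date) (Ng : Date → ℕ) (p : (Fin N → 𝒢) → Prop) : ℝ :=
  (((assigns N 𝒢 Ng).filter p).card : ℝ) / ((assigns N 𝒢 Ng).card : ℝ)

/-- Variance of a real statistic under the uniform distribution on valid assignments. -/
def varE (N : ℕ) (𝒢 : Finset Date) (Ng : Date → ℕ) (f : (Fin N → 𝒢) → ℝ) : ℝ :=
  expec N 𝒢 Ng fun d => (f d - expec N 𝒢 Ng f) ^ 2

/-- Covariance of two real statistics under the uniform distribution on valid assignments. -/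
def covE (N : ℕ) (𝒢 : Finset Date) (Ng : Date → ℕ) (f h : (Fin N → 𝒢) → ℝ) : ℝ :=
  expec N 𝒢 Ng fun d => (f d - expec N 𝒢 Ng f) * (h d - expec N 𝒢 Ng h)

/-- Observed outcome vectors `Y_i = Y_i(G_i)`. -/
def obs {N T : ℕ} {𝒢 : Finset Date} (Y : Fin N → Date → Fin T → ℝ) (d : Fin N → 𝒢) :
    Fin N → Fin T → ℝ := fun i => Y i (d i)

/-- Cohort sample mean `Ȳ_g` computed from outcome data `y` and assignment `d`. -/
def cmean {N T : ℕ} {𝒢 : Finset Date} (Ng : Date → ℕ) (y : Fin N → Fin T → ℝ)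
    (d : Fin N → 𝒢) (g : Date) : Fin T → ℝ :=
  fun t => (∑ i, if (d i : Date) = g then y i t else 0) / (Ng g : ℝ)

/-- Finite-population mean of a scalar attribute. -/
def popMeanS (N : ℕ) (w : Fin N → ℝ) : ℝ := (∑ i, w i) / (N : ℝ)

/-- Finite-population variance (normalized by `N - 1`) of a scalar attribute. -/
def popVarS (N : ℕ) (w : Fin N → ℝ) : ℝ :=
  (∑ i, (w i - popMeanS N w) ^ 2) / ((N : ℝ) - 1)

/-- Finite-population mean of a vector attribute. -/
def popMeanV (N K : ℕ) (W : Fin N → Fin K → ℝ) : Fin K → ℝ := fun k => (∑ i, W i k) / (N : ℝ)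

/-- Finite-population covariance matrix (normalized by `N - 1`) of a vector attribute. -/
def popCov (N K : ℕ) (W : Fin N → Fin K → ℝ) : Matrix (Fin K) (Fin K) ℝ :=
  Matrix.of fun k l =>
    (∑ i, (W i k - popMeanV N K W k) * (W i l - popMeanV N K W l)) / ((N : ℝ) - 1)

/-- Finite-population cross-covariance matrix of two vector attributes. -/
def popCrossCov (N K : ℕ) (W V : Fin N → Fin K → ℝ) : Matrix (Fin K) (Fin K) ℝ :=
  Matrix.of fun k l =>
    (∑ i, (W i k - popMeanV N K W k) * (V i l - popMeanV N K V l)) / ((N : ℝ) - 1)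

/-- `S_g`: finite-population covariance matrix of the potential outcomes `Y(g)`. -/
def Sg (N T : ℕ) (Y : Fin N → Date → Fin T → ℝ) (g : Date) : Matrix (Fin T) (Fin T) ℝ :=
  popCov N T fun i => Y i g

/-- `S_{gg'}`: finite-population cross-covariance of `Y(g)` and `Y(g')`. -/
def Sgg (N T : ℕ) (Y : Fin N → Date → Fin T → ℝ) (g g' : Date) : Matrix (Fin T) (Fin T) ℝ :=
  popCrossCov N T (fun i => Y i g) (fun i => Y i g')

/-- Average treatment contrast `τ_{t,gg'}`. -/
def tau (N T : ℕ) (Y : Fin N → Date → Fin T → ℝ) (t : Fin T) (g g' : Date) : ℝ :=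
  (∑ i, (Y i g t - Y i g' t)) / (N : ℝ)

/-- Target parameter `θ = Σ_{t,g,g'} a_{t,gg'} τ_{t,gg'}`. -/
def thetaParam (N T : ℕ) (𝒢 : Finset Date) (Y : Fin N → Date → Fin T → ℝ)
    (a : Fin T → Date → Date → ℝ) : ℝ :=
  ∑ t, ∑ g ∈ 𝒢, ∑ g' ∈ 𝒢, a t g g' * tau N T Y t g g'

/-- Sample analog `θ̂₀` computed from outcome data `y` and assignment `d`. -/
def thetaHat0 {N T : ℕ} (𝒢 : Finset Date) (Ng : Date → ℕ) (a : Fin T → Date → Date → ℝ)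
    (y : Fin N → Fin T → ℝ) (d : Fin N → 𝒢) : ℝ :=
  ∑ t, ∑ g ∈ 𝒢, ∑ g' ∈ 𝒢, a t g g' * (cmean Ng y d g t - cmean Ng y d g' t)

/-- The statistic `X̂` computed from outcome data `y` and assignment `d`. -/
def Xhat {N T M : ℕ} (𝒢 : Finset Date) (Ng : Date → ℕ)
    (b : Fin M → Fin T → Date → Date → ℝ) (y : Fin N → Fin T → ℝ) (d : Fin N → 𝒢) :
    Fin M → ℝ :=
  fun j => ∑ t, ∑ g ∈ 𝒢, ∑ g' ∈ 𝒢, b j t g g' * (cmean Ng y d g t - cmean Ng y d g' t)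

/-- Induced row vector `A_{θ,g}` of weights on `Ȳ_g` in `θ̂₀`. -/
def Atheta (T : ℕ) (𝒢 : Finset Date) (a : Fin T → Date → Date → ℝ) (g : Date) :
    Fin T → ℝ := fun t => ∑ g' ∈ 𝒢, (a t g g' - a t g' g)

/-- Induced `M × T` matrix `A_{0,g}` of weights on `Ȳ_g` in `X̂`. -/
def A0 (T M : ℕ) (𝒢 : Finset Date) (b : Fin M → Fin T → Date → Date → ℝ) (g : Date) :
    Matrix (Fin M) (Fin T) ℝ :=
  Matrix.of fun j t => ∑ g' ∈ 𝒢, (b j t g g' - b j t g' g)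

/-- `S_θ`: finite-population variance of the unit-level scalars `Σ_g A_{θ,g} Y_i(g)`. -/
def Stheta (N T : ℕ) (𝒢 : Finset Date) (Y : Fin N → Date → Fin T → ℝ)
    (a : Fin T → Date → Date → ℝ) : ℝ :=
  popVarS N fun i => ∑ g ∈ 𝒢, Atheta T 𝒢 a g ⬝ᵥ Y i g

/-- Within-cohort sample covariance `Ŝ_g` from outcome data `y` and assignment `d`. -/
def Shat {N T : ℕ} {𝒢 : Finset Date} (Ng : Date → ℕ) (y : Fin N → Fin T → ℝ)
    (d : Fin N → 𝒢) (g : Date) : Matrix (Fin T) (Fin T) ℝ :=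
  Matrix.of fun t t' =>
    (∑ i, if (d i : Date) = g then
      (y i t - cmean Ng y d g t) * (y i t' - cmean Ng y d g t') else 0) / ((Ng g : ℝ) - 1)

/-- Plug-in estimate `V̂_{X̂}`. -/
def VhatX {N T M : ℕ} (𝒢 : Finset Date) (Ng : Date → ℕ)
    (b : Fin M → Fin T → Date → Date → ℝ) (y : Fin N → Fin T → ℝ) (d : Fin N → 𝒢) :
    Matrix (Fin M) (Fin M) ℝ :=
  ∑ g ∈ 𝒢, ((Ng g : ℝ))⁻¹ • (A0 T M 𝒢 b g * Shat Ng y d g * (A0 T M 𝒢 b g)ᵀ)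

/-- Plug-in estimate `V̂_{X̂,θ̂₀}`. -/
def VhatXtheta {N T M : ℕ} (𝒢 : Finset Date) (Ng : Date → ℕ)
    (a : Fin T → Date → Date → ℝ) (b : Fin M → Fin T → Date → Date → ℝ)
    (y : Fin N → Fin T → ℝ) (d : Fin N → 𝒢) : Fin M → ℝ :=
  ∑ g ∈ 𝒢, ((Ng g : ℝ))⁻¹ • ((A0 T M 𝒢 b g * Shat Ng y d g).mulVec (Atheta T 𝒢 a g))

/-- Plug-in coefficient `β̂* = V̂_{X̂}⁻¹ V̂_{X̂,θ̂₀}`. -/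
def betaHatStar {N T M : ℕ} (𝒢 : Finset Date) (Ng : Date → ℕ)
    (a : Fin T → Date → Date → ℝ) (b : Fin M → Fin T → Date → Date → ℝ)
    (y : Fin N → Fin T → ℝ) (d : Fin N → 𝒢) : Fin M → ℝ :=
  (VhatX 𝒢 Ng b y d)⁻¹.mulVec (VhatXtheta 𝒢 Ng a b y d)

/-- Plug-in efficient estimator `θ̂_{β̂*} = θ̂₀ - X̂'β̂*`. -/
def thetaHatPlug {N T M : ℕ} (𝒢 : Finset Date) (Ng : Date → ℕ)
    (a : Fin T → Date → Date → ℝ) (b : Fin M → Fin T → Date → Date → ℝ)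
    (y : Fin N → Fin T → ℝ) (d : Fin N → 𝒢) : ℝ :=
  thetaHat0 𝒢 Ng a y d - ∑ j, Xhat 𝒢 Ng b y d j * betaHatStar 𝒢 Ng a b y d j

/-- Neyman-style variance estimator `σ̂*²`. -/
def sigmaSqNeyman {N T M : ℕ} (𝒢 : Finset Date) (Ng : Date → ℕ)
    (a : Fin T → Date → Date → ℝ) (b : Fin M → Fin T → Date → Date → ℝ)
    (y : Fin N → Fin T → ℝ) (d : Fin N → 𝒢) : ℝ :=
  (∑ g ∈ 𝒢, ((N : ℝ) / (Ng g : ℝ)) *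
      (Atheta T 𝒢 a g ⬝ᵥ (Shat Ng y d g).mulVec (Atheta T 𝒢 a g)))
  - (∑ g ∈ 𝒢, ((N : ℝ) / (Ng g : ℝ)) •
        ((A0 T M 𝒢 b g * Shat Ng y d g).mulVec (Atheta T 𝒢 a g))) ⬝ᵥ
    ((∑ g ∈ 𝒢, ((N : ℝ) / (Ng g : ℝ)) •
        (A0 T M 𝒢 b g * Shat Ng y d g * (A0 T M 𝒢 b g)ᵀ))⁻¹.mulVec
      (∑ g ∈ 𝒢, ((N : ℝ) / (Ng g : ℝ)) •
        ((A0 T M 𝒢 b g * Shat Ng y d g).mulVec (Atheta T 𝒢 a g))))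

/-- The `(g_min - 1) × T` selection matrix `M` picking out the periods before `g_min`. -/
def Msel (T gmin : ℕ) : Matrix (Fin (gmin - 1)) (Fin T) ℝ :=
  Matrix.of fun k t => if (t : ℕ) = (k : ℕ) then 1 else 0

/-- `β̂_g = (M Ŝ_g M')⁻¹ M Ŝ_g A_{θ,g}'`. -/
def betaHatg {N T : ℕ} {𝒢 : Finset Date} (Ng : Date → ℕ) (a : Fin T → Date → Date → ℝ)
    (gmin : ℕ) (y : Fin N → Fin T → ℝ) (d : Fin N → 𝒢) (g : Date) : Fin (gmin - 1) → ℝ :=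
  (Msel T gmin * Shat Ng y d g * (Msel T gmin)ᵀ)⁻¹.mulVec
    ((Msel T gmin * Shat Ng y d g).mulVec (Atheta T 𝒢 a g))

/-- Refined variance estimator `σ̂**²`. -/
def sigmaSqRefined {N T M : ℕ} (𝒢 : Finset Date) (Ng : Date → ℕ)
    (a : Fin T → Date → Date → ℝ) (b : Fin M → Fin T → Date → Date → ℝ) (gmin : ℕ)
    (y : Fin N → Fin T → ℝ) (d : Fin N → 𝒢) : ℝ :=
  sigmaSqNeyman 𝒢 Ng a b y d -
    (∑ g ∈ 𝒢.filter fun g => (gmin : Date) ≤ g, betaHatg Ng a gmin y d g) ⬝ᵥ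
      ((Msel T gmin * Shat Ng y d (gmin : Date) * (Msel T gmin)ᵀ).mulVec
        (∑ g ∈ 𝒢.filter fun g => (gmin : Date) ≤ g, betaHatg Ng a gmin y d g))

/-- Studentized plug-in efficient statistic `t = θ̂_{β̂*} / (σ̂** / √N)`. -/
def tstat {N T M : ℕ} (𝒢 : Finset Date) (Ng : Date → ℕ)
    (a : Fin T → Date → Date → ℝ) (b : Fin M → Fin T → Date → Date → ℝ) (gmin : ℕ)
    (y : Fin N → Fin T → ℝ) (d : Fin N → 𝒢) : ℝ :=
  thetaHatPlug 𝒢 Ng a b y d /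
    (Real.sqrt (sigmaSqRefined 𝒢 Ng a b gmin y d) / Real.sqrt (N : ℝ))

/-- Fisher randomization test p-value for the statistic `stat`, based on observed data
`(Y(G), G)` and recomputing the statistic with permuted assignments. -/
def pFRT {N T : ℕ} {𝒢 : Finset Date} (stat : (Fin N → Fin T → ℝ) → (Fin N → 𝒢) → ℝ)
    (Y : Fin N → Date → Fin T → ℝ) (d : Fin N → 𝒢) : ℝ :=
  (((Finset.univ : Finset (Equiv.Perm (Fin N))).filter fun π =>
      stat (obs Y d) (fun i => d (π i)) ≥ stat (obs Y d) d).card : ℝ) /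
    ((Finset.univ : Finset (Equiv.Perm (Fin N))).card : ℝ)

/-- Limit covariance matrix `V*_{X̂}`. -/
def VstarX (T M : ℕ) (𝒢 : Finset Date) (b : Fin M → Fin T → Date → Date → ℝ)
    (p : Date → ℝ) (Sstar : Date → Matrix (Fin T) (Fin T) ℝ) : Matrix (Fin M) (Fin M) ℝ :=
  ∑ g ∈ 𝒢, (p g)⁻¹ • (A0 T M 𝒢 b g * Sstar g * (A0 T M 𝒢 b g)ᵀ)

/-- Limit covariance vector `V*_{X̂,θ̂₀}`. -/
def VstarXtheta (T M : ℕ) (𝒢 : Finset Date) (a : Fin T → Date → Date → ℝ)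
    (b : Fin M → Fin T → Date → Date → ℝ) (p : Date → ℝ)
    (Sstar : Date → Matrix (Fin T) (Fin T) ℝ) : Fin M → ℝ :=
  ∑ g ∈ 𝒢, (p g)⁻¹ • ((A0 T M 𝒢 b g * Sstar g).mulVec (Atheta T 𝒢 a g))

/-- Limit variance `V*_{θ̂₀}`. -/
def VstarTheta (T : ℕ) (𝒢 : Finset Date) (a : Fin T → Date → Date → ℝ) (p : Date → ℝ)
    (Sstar : Date → Matrix (Fin T) (Fin T) ℝ) (Sthetastar : ℝ) : ℝ :=
  (∑ g ∈ 𝒢, (p g)⁻¹ * (Atheta T 𝒢 a g ⬝ᵥ (Sstar g).mulVec (Atheta T 𝒢 a g))) - Sthetastar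

/-- Asymptotic variance `σ*²` of the (plug-in) efficient estimator. -/
def sigmaSqLim (T M : ℕ) (𝒢 : Finset Date) (a : Fin T → Date → Date → ℝ)
    (b : Fin M → Fin T → Date → Date → ℝ) (p : Date → ℝ)
    (Sstar : Date → Matrix (Fin T) (Fin T) ℝ) (Sthetastar : ℝ) : ℝ :=
  VstarTheta T 𝒢 a p Sstar Sthetastar -
    VstarXtheta T M 𝒢 a b p Sstar ⬝ᵥ
      (VstarX T M 𝒢 b p Sstar)⁻¹.mulVec (VstarXtheta T M 𝒢 a b p Sstar)

/-- A bounded real function. -/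
def IsBounded (f : ℝ → ℝ) : Prop := ∃ C, ∀ x, |f x| ≤ C

end Staggered

namespace Staggered

lemma sum_assigns_perm {N : ℕ} {𝒢 : Finset Date} {Ng : Date → ℕ} (σ : Equiv.Perm (Fin N))
    (f : (Fin N → 𝒢) → ℝ) :
    ∑ d ∈ assigns N 𝒢 Ng, f (d ∘ σ) = ∑ d ∈ assigns N 𝒢 Ng, f d := by
  refine Finset.sum_equiv (σ.symm.arrowCongr (Equiv.refl _)) ?_ ?_
  · intro d
    simp only [assigns, Finset.mem_filter, Finset.mem_univ, true_and]
    refine forall₂_congr fun g _ => ?_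
    have : (Finset.univ.filter fun i => (d i : Date) = g).card
        = (Finset.univ.filter fun i =>
            ((σ.symm.arrowCongr (Equiv.refl 𝒢) d) i : Date) = g).card := by
      refine Finset.card_equiv σ.symm ?_
      intro i
      simp [Equiv.arrowCongr]
    rw [this]
  · intro d _
    rfl

/-- treatment indicator -/
def ind {N : ℕ} {𝒢 : Finset Date} (g : Date) (d : Fin N → 𝒢) (i : Fin N) : ℝ :=
  if (d i : Date) = g then 1 else 0

lemma ind_sum {N : ℕ} {𝒢 : Finset Date} {Ng : Date → ℕ} {g : Date} (hg : g ∈ 𝒢)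
    {d : Fin N → 𝒢} (hd : d ∈ assigns N 𝒢 Ng) : ∑ i, ind g d i = Ng g := by
  simp only [assigns, Finset.mem_filter, Finset.mem_univ, true_and] at hd
  rw [← hd g hg]
  simp [ind, Finset.sum_boole]

lemma ind_mul_self {N : ℕ} {𝒢 : Finset Date} (g : Date) (d : Fin N → 𝒢) (i : Fin N) :
    ind g d i * ind g d i = ind g d i := by
  unfold ind; split_ifs <;> simp

lemma sum_ind {N : ℕ} {𝒢 : Finset Date} {Ng : Date → ℕ} {g : Date} (hg : g ∈ 𝒢) (i : Fin N) :
    (N : ℝ) * ∑ d ∈ assigns N 𝒢 Ng, ind g d i = Ng g * (assigns N 𝒢 Ng).card := by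
  have h : ∀ j, ∑ d ∈ assigns N 𝒢 Ng, ind g d j = ∑ d ∈ assigns N 𝒢 Ng, ind g d i := by
    intro j
    rw [← sum_assigns_perm (Equiv.swap i j) (fun d => ind g d i)]
    simp [ind]
  have h2 : ∑ j : Fin N, ∑ d ∈ assigns N 𝒢 Ng, ind g d j = Ng g * (assigns N 𝒢 Ng).card := by
    rw [Finset.sum_comm, Finset.sum_congr rfl (fun d hd => ind_sum hg hd)]
    simp [mul_comm]
  rw [← h2, Finset.sum_congr rfl (fun j _ => h j)]
  simp

lemma sum_ind_ind {N : ℕ} {𝒢 : Finset Date} {Ng : Date → ℕ} {g : Date} (hg : g ∈ 𝒢)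
    {i j : Fin N} (hij : i ≠ j) :
    (N : ℝ) * ((N : ℝ) - 1) * ∑ d ∈ assigns N 𝒢 Ng, ind g d i * ind g d j
      = (Ng g - 1) * Ng g * (assigns N 𝒢 Ng).card := by
  have h : ∀ k ∈ Finset.univ.erase i, ∑ d ∈ assigns N 𝒢 Ng, ind g d i * ind g d k
      = ∑ d ∈ assigns N 𝒢 Ng, ind g d i * ind g d j := by
    intro k hk
    have hk : k ≠ i := by simpa using hk
    rw [← sum_assigns_perm (Equiv.swap j k) (fun d => ind g d i * ind g d j)]
    simp [ind, Equiv.swap_apply_of_ne_of_ne hij hk.symm]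
  have h2 : ∑ k ∈ Finset.univ.erase i, ∑ d ∈ assigns N 𝒢 Ng, ind g d i * ind g d k
      = (Ng g - 1) * ∑ d ∈ assigns N 𝒢 Ng, ind g d i := by
    rw [Finset.sum_comm, Finset.mul_sum]
    refine Finset.sum_congr rfl fun d hd => ?_
    have h3 := ind_sum hg hd
    rw [← Finset.add_sum_erase _ _ (Finset.mem_univ i)] at h3
    rw [← Finset.mul_sum, show ∑ k ∈ Finset.univ.erase i, ind g d k = Ng g - ind g d i by linarith,
      mul_sub, ind_mul_self]
    ring
  rw [Finset.sum_congr rfl h, Finset.sum_const, Finset.card_erase_of_mem (Finset.mem_univ i)] at h2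
  have hN : 1 ≤ N := by have := i.2; omega
  simp only [Finset.card_univ, Fintype.card_fin, nsmul_eq_mul, Nat.cast_sub hN, Nat.cast_one] at h2
  have := sum_ind (Ng := Ng) hg i
  rw [mul_assoc, h2, mul_left_comm, this]; ring

lemma second_moment {N : ℕ} {𝒢 : Finset Date} {Ng : Date → ℕ} {g : Date} (hg : g ∈ 𝒢)
    (hN : 2 ≤ N) (h1 : 1 ≤ Ng g) (w : Fin N → ℝ) (hw : ∑ i, w i = 0) :
    ∑ d ∈ assigns N 𝒢 Ng, (∑ i, ind g d i * w i) ^ 2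
      ≤ (Ng g : ℝ) / N * (∑ i, w i ^ 2) * (assigns N 𝒢 Ng).card := by
  have hN' : (2 : ℝ) ≤ N := by exact_mod_cast hN
  have h1' : (1 : ℝ) ≤ Ng g := by exact_mod_cast h1
  set c : ℝ := ((assigns N 𝒢 Ng).card : ℝ) with hc
  set q1 : ℝ := Ng g / N * c with hq1
  set q2 : ℝ := (Ng g - 1) * Ng g * c / (N * (N - 1)) with hq2
  have hN0 : (N : ℝ) ≠ 0 := by positivity
  have hN1 : (N : ℝ) - 1 ≠ 0 := by linarith
  have e : ∀ i j, ∑ d ∈ assigns N 𝒢 Ng, ind g d i * ind g d j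
      = q2 + if i = j then q1 - q2 else 0 := by
    intro i j
    split_ifs with h
    · subst h
      simp only [ind_mul_self]
      have := sum_ind (Ng := Ng) hg i
      rw [hq1]; field_simp; linarith
    · have := sum_ind_ind (Ng := Ng) hg h
      rw [hq2, add_zero, eq_div_iff (mul_ne_zero hN0 hN1), mul_comm, this]
  have key : ∑ d ∈ assigns N 𝒢 Ng, (∑ i, ind g d i * w i) ^ 2 = (q1 - q2) * ∑ i, w i ^ 2 := by
    calc _ = ∑ d ∈ assigns N 𝒢 Ng, ∑ i, ∑ j, (ind g d i * ind g d j) * (w i * w j) := by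
          refine Finset.sum_congr rfl fun d _ => ?_
          rw [sq, Finset.sum_mul_sum]
          refine Finset.sum_congr rfl fun i _ => Finset.sum_congr rfl fun j _ => by ring
      _ = ∑ i, ∑ j, (q2 + if i = j then q1 - q2 else 0) * (w i * w j) := by
          rw [Finset.sum_comm]
          refine Finset.sum_congr rfl fun i _ => ?_
          rw [Finset.sum_comm]
          refine Finset.sum_congr rfl fun j _ => ?_
          rw [← e, Finset.sum_mul]
      _ = q2 * ((∑ i, w i) * (∑ j, w j)) + (q1 - q2) * ∑ i, w i ^ 2 := by
          rw [Finset.sum_mul_sum]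
          simp only [add_mul, Finset.sum_add_distrib, Finset.mul_sum, ite_mul, zero_mul,
            Finset.sum_ite_eq, Finset.mem_univ, if_true, sq]
      _ = _ := by rw [hw]; ring
  have hq2n : 0 ≤ q2 := by
    rw [hq2]
    apply div_nonneg
    · exact mul_nonneg (mul_nonneg (by linarith) (by linarith)) (by positivity)
    · exact mul_nonneg (by linarith) (by linarith)
  have hs : 0 ≤ ∑ i, w i ^ 2 := Finset.sum_nonneg fun i _ => sq_nonneg _
  rw [key]
  have : (Ng g : ℝ) / N * (∑ i, w i ^ 2) * c = q1 * ∑ i, w i ^ 2 := by rw [hq1]; ring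
  rw [this]
  nlinarith

lemma prob_mono {N : ℕ} {𝒢 : Finset Date} {Ng : Date → ℕ} {p q : (Fin N → 𝒢) → Prop}
    (h : ∀ d ∈ assigns N 𝒢 Ng, p d → q d) : prob N 𝒢 Ng p ≤ prob N 𝒢 Ng q := by
  unfold prob
  gcongr ?_ / _
  norm_cast
  refine Finset.card_le_card fun d hd => ?_
  simp only [Finset.mem_filter] at hd ⊢
  exact ⟨hd.1, h d hd.1 hd.2⟩

lemma prob_nonneg {N : ℕ} {𝒢 : Finset Date} {Ng : Date → ℕ} (p : (Fin N → 𝒢) → Prop) :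
    0 ≤ prob N 𝒢 Ng p := by unfold prob; positivity

lemma prob_or {N : ℕ} {𝒢 : Finset Date} {Ng : Date → ℕ} (p q : (Fin N → 𝒢) → Prop) :
    prob N 𝒢 Ng (fun d => p d ∨ q d) ≤ prob N 𝒢 Ng p + prob N 𝒢 Ng q := by
  unfold prob
  rw [← add_div]
  gcongr ?_ / _
  norm_cast
  refine le_trans (Finset.card_le_card ?_) (Finset.card_union_le _ _)
  intro d hd
  simp only [Finset.mem_filter, Finset.mem_union] at hd ⊢
  tauto

lemma prob_false {N : ℕ} {𝒢 : Finset Date} {Ng : Date → ℕ} {p : (Fin N → 𝒢) → Prop}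
    (h : ∀ d ∈ assigns N 𝒢 Ng, ¬ p d) : prob N 𝒢 Ng p = 0 := by
  unfold prob
  rw [Finset.filter_false_of_mem h]; simp

lemma cheb {N : ℕ} {𝒢 : Finset Date} {Ng : Date → ℕ} (f : (Fin N → 𝒢) → ℝ) (B : ℝ) (hB : 0 ≤ B)
    (h : ∑ d ∈ assigns N 𝒢 Ng, f d ^ 2 ≤ B * (assigns N 𝒢 Ng).card) (ε : ℝ) (hε : 0 < ε) :
    prob N 𝒢 Ng (fun d => ε ≤ |f d|) ≤ B / ε ^ 2 := by
  unfold prob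
  rcases Nat.eq_zero_or_pos (assigns N 𝒢 Ng).card with h0 | h0
  · rw [h0]; simp; positivity
  have h0' : (0 : ℝ) < (assigns N 𝒢 Ng).card := by exact_mod_cast h0
  rw [div_le_div_iff₀ h0' (by positivity)]
  refine le_trans ?_ h
  rw [← nsmul_eq_mul, ← Finset.sum_const]
  refine le_trans ?_ (Finset.sum_le_sum_of_subset_of_nonneg
    (Finset.filter_subset (fun d => ε ≤ |f d|) _) (fun _ _ _ => sq_nonneg _))
  refine Finset.sum_le_sum fun d hd => ?_
  have := (Finset.mem_filter.1 hd).2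
  rw [← sq_abs (f d)]
  gcongr

/-- Filter encoding convergence in probability. -/
def pfil (N : ℕ → ℕ) (𝒢 : Finset Date) (Ng : ℕ → Date → ℕ) : Filter (Σ m, Fin (N m) → 𝒢) where
  sets := {s | Tendsto (fun m => prob (N m) 𝒢 (Ng m) fun d => (⟨m, d⟩ : Σ m, Fin (N m) → 𝒢) ∉ s)
    atTop (𝓝 0)}
  univ_sets := by
    simp only [Set.mem_ofPred_eq]
    refine tendsto_const_nhds.congr fun m => (prob_false ?_).symm
    simp
  sets_of_superset := by
    intro s t hs hst
    refine squeeze_zero (fun m => prob_nonneg _) (fun m => prob_mono ?_) hs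
    intro d _ h h'
    exact h (hst h')
  inter_sets := by
    intro s t hs ht
    have := Tendsto.add hs ht
    rw [add_zero] at this
    refine squeeze_zero (fun m => prob_nonneg _) (fun m => ?_) this
    refine le_trans (prob_mono ?_) (prob_or _ _)
    intro d _ h
    simpa [Set.mem_inter_iff, not_and_or, imp_iff_not_or] using h

lemma pfil_eventually {N : ℕ → ℕ} {𝒢 : Finset Date} {Ng : ℕ → Date → ℕ}
    (P : (Σ m, Fin (N m) → 𝒢) → Prop) :
    (∀ᶠ x in pfil N 𝒢 Ng, P x) ↔
      Tendsto (fun m => prob (N m) 𝒢 (Ng m) fun d => ¬ P ⟨m, d⟩) atTop (𝓝 0) := Iff.rfl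

lemma pfil_assigns {N : ℕ → ℕ} {𝒢 : Finset Date} {Ng : ℕ → Date → ℕ} :
    ∀ᶠ x in pfil N 𝒢 Ng, x.2 ∈ assigns (N x.1) 𝒢 (Ng x.1) := by
  rw [pfil_eventually]
  refine tendsto_const_nhds.congr fun m => (prob_false ?_).symm
  simp

lemma pfil_fst {N : ℕ → ℕ} {𝒢 : Finset Date} {Ng : ℕ → Date → ℕ} :
    Tendsto (fun x : Σ m, Fin (N m) → 𝒢 => x.1) (pfil N 𝒢 Ng) atTop := by
  intro s hs
  rw [Filter.mem_map]
  show Tendsto _ _ _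
  refine tendsto_const_nhds.congr' ?_
  filter_upwards [hs] with m hm
  exact (prob_false (by simpa using fun _ _ => hm)).symm

lemma pfil_lln {N : ℕ → ℕ} {𝒢 : Finset Date} {Ng : ℕ → Date → ℕ} {g : Date} (hg : g ∈ 𝒢)
    (hN2 : ∀ m, 2 ≤ N m) (hNg : ∀ m, 1 ≤ Ng m g) {p : ℝ} (hp : 0 < p)
    (hpc : Tendsto (fun m => (Ng m g : ℝ) / (N m : ℝ)) atTop (𝓝 p))
    (w : ∀ m, Fin (N m) → ℝ)
    (hw : Tendsto (fun m => (∑ i, w m i ^ 2) / (N m : ℝ) ^ 2) atTop (𝓝 0)) :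
    Tendsto (fun x : Σ m, Fin (N m) → 𝒢 =>
      (∑ i, ind g x.2 i * w x.1 i) / (Ng x.1 g : ℝ) - (∑ i, w x.1 i) / (N x.1 : ℝ))
      (pfil N 𝒢 Ng) (𝓝 0) := by
  rw [Metric.tendsto_nhds]
  intro ε hε
  rw [pfil_eventually]
  have hlim : Tendsto (fun m => ((∑ i, w m i ^ 2) / (N m : ℝ) ^ 2 /
      ((Ng m g : ℝ) / (N m : ℝ))) / ε ^ 2) atTop (𝓝 0) := by
    have := (hw.div hpc hp.ne').div_const (ε ^ 2)
    simpa using this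
  refine squeeze_zero (fun m => prob_nonneg _) (fun m => ?_) hlim
  have hN0 : (0 : ℝ) < N m := by have := hN2 m; positivity
  have hG0 : (0 : ℝ) < Ng m g := by exact_mod_cast hNg m
  set μ : ℝ := (∑ i, w m i) / (N m : ℝ) with hμ
  have hc : ∑ i, (w m i - μ) = 0 := by
    rw [Finset.sum_sub_distrib]; simp [hμ]; field_simp; simp
  have hv : ∑ i, (w m i - μ) ^ 2 ≤ ∑ i, w m i ^ 2 := by
    have : ∑ i, (w m i - μ) ^ 2 = ∑ i, w m i ^ 2 - N m * μ ^ 2 := by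
      have h1 : ∀ i, (w m i - μ) ^ 2 = w m i ^ 2 - 2 * μ * w m i + μ ^ 2 := fun i => by ring
      simp only [h1, Finset.sum_add_distrib, Finset.sum_sub_distrib, ← Finset.mul_sum]
      have h2 : ∑ i, w m i = N m * μ := by rw [hμ]; field_simp
      rw [h2]; simp; ring
    rw [this]
    nlinarith [sq_nonneg μ]
  have hsm := second_moment (Ng := Ng m) hg (hN2 m) (hNg m) _ hc
  have := cheb (Ng := Ng m) (fun d : Fin (N m) → 𝒢 => (∑ i, ind g d i * (w m i - μ)) / (Ng m g : ℝ))
    ((∑ i, w m i ^ 2) / (N m : ℝ) ^ 2 / ((Ng m g : ℝ) / (N m : ℝ)))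
    (div_nonneg (div_nonneg (Finset.sum_nonneg fun i _ => sq_nonneg _) (by positivity))
      (by positivity)) ?_ ε hε
  · refine le_trans (prob_mono ?_) this
    intro d hd h
    have hs := ind_sum hg hd
    simp only [dist_zero_right, Real.norm_eq_abs, not_lt] at h
    have he : (∑ i, ind g d i * (w m i - μ)) / (Ng m g : ℝ)
        = (∑ i, ind g d i * w m i) / (Ng m g : ℝ) - μ := by
      simp only [mul_sub, Finset.sum_sub_distrib, ← Finset.sum_mul, hs]
      field_simp
    rw [he]
    exact h
  · simp only [div_pow]
    rw [← Finset.sum_div, div_le_iff₀ (by positivity)]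
    refine hsm.trans ?_
    calc _ ≤ (Ng m g : ℝ) / (N m) * (∑ i, w m i ^ 2) * (assigns (N m) 𝒢 (Ng m)).card := by gcongr
      _ = _ := by field_simp

end Staggered

namespace Staggered

lemma shat_eq {N T : ℕ} {𝒢 : Finset Date} {Ng : Date → ℕ} {g : Date} (hg : g ∈ 𝒢)
    (h1 : 1 ≤ Ng g) (Y : Fin N → Date → Fin T → ℝ) {d : Fin N → 𝒢} (hd : d ∈ assigns N 𝒢 Ng)
    (t t' : Fin T) (μ ν : ℝ) :
    Shat Ng (obs Y d) d g t t' = (1 - (Ng g : ℝ)⁻¹)⁻¹ *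
      ((∑ i, ind g d i * ((Y i g t - μ) * (Y i g t' - ν))) / (Ng g : ℝ)
        - (∑ i, ind g d i * (Y i g t - μ)) / (Ng g : ℝ)
          * ((∑ i, ind g d i * (Y i g t' - ν)) / (Ng g : ℝ))) := by
  have hn : (Ng g : ℝ) ≠ 0 := by positivity
  have hs := ind_sum hg hd
  have hc : ∀ (s : Fin T) (κ : ℝ), cmean Ng (obs Y d) d g s
      = κ + (∑ i, ind g d i * (Y i g s - κ)) / (Ng g : ℝ) := by
    intro s κ
    have e : ∀ i, (if (d i : Date) = g then obs Y d i s else 0)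
        = ind g d i * (Y i g s - κ) + ind g d i * κ := by
      intro i; unfold ind obs
      split_ifs with h
      · rw [h]; ring
      · ring
    unfold cmean
    simp only [e, Finset.sum_add_distrib, ← Finset.sum_mul, hs]
    field_simp
    ring
  unfold Shat
  rw [Matrix.of_apply]
  rw [hc t μ, hc t' ν]
  set U := ∑ i, ind g d i * (Y i g t - μ) with hU
  set V := ∑ i, ind g d i * (Y i g t' - ν) with hV
  set n := (Ng g : ℝ) with hnn
  have e : ∀ i, (if (d i : Date) = g then
      (obs Y d i t - (μ + U / n)) * (obs Y d i t' - (ν + V / n)) else 0)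
      = ind g d i * ((Y i g t - μ) * (Y i g t' - ν)) - ind g d i * (Y i g t - μ) * (V / n)
        - ind g d i * (Y i g t' - ν) * (U / n) + ind g d i * (U / n * (V / n)) := by
    intro i; unfold ind obs
    split_ifs with h
    · rw [h]; ring
    · ring
  simp only [e, Finset.sum_add_distrib, Finset.sum_sub_distrib, ← Finset.sum_mul, hs, ← hU, ← hV]
  have h3 : (1 - n⁻¹)⁻¹ = n / (n - 1) := by
    rw [show 1 - n⁻¹ = (n - 1) / n by field_simp, inv_div]
  rw [h3]
  field_simp
  ring

lemma shat_tendsto {T : ℕ} {N : ℕ → ℕ} {𝒢 : Finset Date} {Ng : ℕ → Date → ℕ} {g : Date}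
    (hg : g ∈ 𝒢) (Y : ∀ m, Fin (N m) → Date → Fin T → ℝ)
    (hN2 : ∀ m, 2 ≤ N m) (hNtop : Tendsto N atTop atTop) (hNg : ∀ m, 1 ≤ Ng m g)
    {p : ℝ} (hp : 0 < p)
    (hpc : Tendsto (fun m => (Ng m g : ℝ) / (N m : ℝ)) atTop (𝓝 p))
    {S : Matrix (Fin T) (Fin T) ℝ}
    (hS : ∀ t t' : Fin T, Tendsto (fun m => Sg (N m) T (Y m) g t t') atTop (𝓝 (S t t')))
    (hLind : ∀ ε > (0 : ℝ), ∀ᶠ m in atTop, ∀ (i : Fin (N m)),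
      (∑ t, (Y m i g t - popMeanS (N m) fun i' => Y m i' g t) ^ 2) / (N m : ℝ) < ε)
    (t t' : Fin T) :
    Tendsto (fun x : Σ m, Fin (N m) → 𝒢 =>
      Shat (Ng x.1) (obs (Y x.1) x.2) x.2 g t t') (pfil N 𝒢 Ng) (𝓝 (S t t')) := by
  have hN0 : ∀ m, (0 : ℝ) < N m := fun m => by have := hN2 m; positivity
  have hN1 : ∀ m, (0 : ℝ) < (N m : ℝ) - 1 := fun m => by
    have : (2 : ℝ) ≤ N m := by exact_mod_cast hN2 m
    linarith
  have hNr : Tendsto (fun m => (N m : ℝ)) atTop atTop := tendsto_natCast_atTop_atTop.comp hNtop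
  have hNi : Tendsto (fun m => (N m : ℝ)⁻¹) atTop (𝓝 0) := tendsto_inv_atTop_zero.comp hNr
  have hnr : Tendsto (fun m => (Ng m g : ℝ)) atTop atTop := by
    refine (hpc.pos_mul_atTop hp hNr).congr fun m => ?_
    have := (hN0 m).ne'
    field_simp
  have hni : Tendsto (fun m => (1 - (Ng m g : ℝ)⁻¹)⁻¹) atTop (𝓝 1) := by
    have h := (tendsto_const_nhds (x := (1 : ℝ))).sub (tendsto_inv_atTop_zero.comp hnr)
    rw [sub_zero] at h
    simpa using h.inv₀ one_ne_zero
  -- centered outcomes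
  let u : ∀ (s : Fin T) m, Fin (N m) → ℝ := fun s m i =>
    Y m i g s - popMeanS (N m) fun i' => Y m i' g s
  have hu0 : ∀ s m, ∑ i, u s m i = 0 := by
    intro s m
    have := (hN0 m).ne'
    simp only [u, Finset.sum_sub_distrib, popMeanS]
    simp; field_simp; simp
  have huv : ∀ s s' m, (∑ i, u s m i * u s' m i) / (N m : ℝ)
      = Sg (N m) T (Y m) g s s' * (1 - (N m : ℝ)⁻¹) := by
    intro s s' m
    have h0 := (hN0 m).ne'
    have h1 := (hN1 m).ne'
    simp only [Sg, popCov, popMeanV, Matrix.of_apply, u, popMeanS]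
    rw [show 1 - (N m : ℝ)⁻¹ = ((N m : ℝ) - 1) / N m by field_simp, div_mul_div_cancel₀ h1]
  have huvlim : ∀ s s', Tendsto (fun m => (∑ i, u s m i * u s' m i) / (N m : ℝ)) atTop
      (𝓝 (S s s')) := by
    intro s s'
    simp only [huv]
    have := (hS s s').mul ((tendsto_const_nhds (x := (1 : ℝ))).sub hNi)
    simpa using this
  have hul : ∀ s, Tendsto (fun x : Σ m, Fin (N m) → 𝒢 =>
      (∑ i, ind g x.2 i * u s x.1 i) / (Ng x.1 g : ℝ)) (pfil N 𝒢 Ng) (𝓝 0) := by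
    intro s
    have := pfil_lln (𝒢 := 𝒢) hg hN2 hNg hp hpc (u s) ?_
    · refine this.congr fun x => ?_
      rw [hu0]; simp
    · have := (huvlim s s).mul hNi
      rw [mul_zero] at this
      refine this.congr fun m => ?_
      have h0 := (hN0 m).ne'
      simp only [← sq]
      field_simp
  have hmax : Tendsto (fun m => (∑ i, (u t m i * u t' m i) ^ 2) / (N m : ℝ) ^ 2) atTop (𝓝 0) := by
    -- bounded by ε times a convergent sequence
    rw [Metric.tendsto_nhds]
    intro ε hε
    have hSn : 0 ≤ S t' t' := ge_of_tendsto' (huvlim t' t') fun m =>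
      div_nonneg (Finset.sum_nonneg fun i _ => mul_self_nonneg _) (hN0 m).le
    have hδ : 0 < ε / (S t' t' + 1) := by positivity
    filter_upwards [hLind _ hδ, (huvlim t' t').eventually_lt_const (lt_add_one _)] with m h1 h2
    have hbd : ∀ i, u t m i ^ 2 ≤ ε / (S t' t' + 1) * N m := by
      intro i
      have h3 := (div_lt_iff₀ (hN0 m)).1 (h1 i)
      refine le_trans ?_ h3.le
      exact Finset.single_le_sum (f := fun s => u s m i ^ 2) (fun s _ => sq_nonneg _)
        (Finset.mem_univ t)
    have hnn : 0 ≤ (∑ i, (u t m i * u t' m i) ^ 2) / (N m : ℝ) ^ 2 :=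
      div_nonneg (Finset.sum_nonneg fun i _ => sq_nonneg _) (by positivity)
    rw [dist_zero_right, Real.norm_eq_abs, abs_of_nonneg hnn]
    calc _ ≤ (∑ i, (ε / (S t' t' + 1) * N m) * (u t' m i * u t' m i)) / (N m : ℝ) ^ 2 := by
          gcongr with i
          rw [mul_pow, ← sq]
          exact mul_le_mul_of_nonneg_right (hbd i) (sq_nonneg _)
      _ = ε / (S t' t' + 1) * ((∑ i, u t' m i * u t' m i) / (N m : ℝ)) := by
          rw [← Finset.mul_sum]
          have h0 := (hN0 m).ne'
          field_simp
      _ < ε / (S t' t' + 1) * (S t' t' + 1) := by gcongr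
      _ = ε := by field_simp
  have hcl : Tendsto (fun x : Σ m, Fin (N m) → 𝒢 =>
      (∑ i, ind g x.2 i * (u t x.1 i * u t' x.1 i)) / (Ng x.1 g : ℝ)) (pfil N 𝒢 Ng)
      (𝓝 (S t t')) := by
    have h := pfil_lln (𝒢 := 𝒢) hg hN2 hNg hp hpc (fun m i => u t m i * u t' m i) hmax
    have h2 := h.add ((huvlim t t').comp pfil_fst)
    rw [zero_add] at h2
    refine h2.congr fun x => ?_
    simp
  have hfin := (hni.comp pfil_fst).mul (hcl.sub ((hul t).mul (hul t')))
  rw [mul_zero, sub_zero, one_mul] at hfin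
  refine hfin.congr' ?_
  filter_upwards [pfil_assigns] with x hx
  rw [shat_eq hg (hNg x.1) (Y x.1) hx t t' (popMeanS (N x.1) fun i' => Y x.1 i' g t)
    (popMeanS (N x.1) fun i' => Y x.1 i' g t')]
  rfl

end Staggered

namespace Staggered

section
variable {α : Type*} {L : Filter α} {m n k : ℕ}

lemma tm_mul {A : α → Matrix (Fin m) (Fin n) ℝ} {B : α → Matrix (Fin n) (Fin k) ℝ}
    {a : Matrix (Fin m) (Fin n) ℝ} {b : Matrix (Fin n) (Fin k) ℝ}
    (hA : Tendsto A L (𝓝 a)) (hB : Tendsto B L (𝓝 b)) :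
    Tendsto (fun x => A x * B x) L (𝓝 (a * b)) :=
  ((continuous_fst.matrix_mul continuous_snd).tendsto (a, b)).comp (hA.prodMk_nhds hB)

lemma tm_mulVec {A : α → Matrix (Fin m) (Fin n) ℝ} {B : α → Fin n → ℝ}
    {a : Matrix (Fin m) (Fin n) ℝ} {b : Fin n → ℝ}
    (hA : Tendsto A L (𝓝 a)) (hB : Tendsto B L (𝓝 b)) :
    Tendsto (fun x => (A x).mulVec (B x)) L (𝓝 (a.mulVec b)) :=
  ((continuous_fst.matrix_mulVec continuous_snd).tendsto (a, b)).comp (hA.prodMk_nhds hB)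

lemma tm_dot {A : α → Fin n → ℝ} {B : α → Fin n → ℝ} {a b : Fin n → ℝ}
    (hA : Tendsto A L (𝓝 a)) (hB : Tendsto B L (𝓝 b)) :
    Tendsto (fun x => A x ⬝ᵥ B x) L (𝓝 (a ⬝ᵥ b)) :=
  ((continuous_fst.dotProduct continuous_snd).tendsto (a, b)).comp (hA.prodMk_nhds hB)

lemma tm_inv {A : α → Matrix (Fin n) (Fin n) ℝ} {a : Matrix (Fin n) (Fin n) ℝ}
    (hA : Tendsto A L (𝓝 a)) (ha : IsUnit a) :
    Tendsto (fun x => (A x)⁻¹) L (𝓝 a⁻¹) := by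
  have hd : a.det ≠ 0 := ((Matrix.isUnit_iff_isUnit_det _).1 ha).ne_zero
  have h1 : Tendsto (fun x => (A x).det) L (𝓝 a.det) :=
    ((continuous_id.matrix_det).tendsto a).comp hA
  have h2 : Tendsto (fun x => (A x).adjugate) L (𝓝 a.adjugate) :=
    ((continuous_id.matrix_adjugate).tendsto a).comp hA
  simp only [Matrix.inv_def, Ring.inverse_eq_inv']
  exact (h1.inv₀ hd).smul h2

end

/-- scalar finite-population covariance -/
def pcov (N : ℕ) (w v : Fin N → ℝ) : ℝ :=
  (∑ i, (w i - popMeanS N w) * (v i - popMeanS N v)) / ((N : ℝ) - 1)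

lemma pcov_comm (N : ℕ) (w v : Fin N → ℝ) : pcov N w v = pcov N v w := by
  unfold pcov; simp only [mul_comm]

lemma popMeanS_sum {N : ℕ} {ι : Type*} (s : Finset ι) (c : ι → ℝ) (w : ι → Fin N → ℝ) :
    popMeanS N (fun i => ∑ j ∈ s, c j * w j i) = ∑ j ∈ s, c j * popMeanS N (w j) := by
  unfold popMeanS
  rw [Finset.sum_comm, Finset.sum_div]
  refine Finset.sum_congr rfl fun j _ => ?_
  rw [← Finset.mul_sum, mul_div_assoc]

lemma pcov_sum {N : ℕ} {ι : Type*} (s : Finset ι) (c : ι → ℝ) (w : ι → Fin N → ℝ)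
    (v : Fin N → ℝ) :
    pcov N (fun i => ∑ j ∈ s, c j * w j i) v = ∑ j ∈ s, c j * pcov N (w j) v := by
  unfold pcov
  rw [popMeanS_sum]
  simp only [← Finset.sum_sub_distrib, Finset.sum_mul, ← mul_sub]
  rw [Finset.sum_comm, Finset.sum_div]
  refine Finset.sum_congr rfl fun j _ => ?_
  rw [← mul_div_assoc, Finset.mul_sum]
  simp only [mul_assoc]

lemma pcov_sum_right {N : ℕ} {ι : Type*} (s : Finset ι) (c : ι → ℝ) (w : ι → Fin N → ℝ)
    (v : Fin N → ℝ) :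
    pcov N v (fun i => ∑ j ∈ s, c j * w j i) = ∑ j ∈ s, c j * pcov N v (w j) := by
  rw [pcov_comm, pcov_sum]
  simp only [pcov_comm]

lemma pcov_sub_nonneg {N : ℕ} (hN : 2 ≤ N) (w v : Fin N → ℝ) :
    0 ≤ popVarS N w - 2 * pcov N v w + pcov N v v := by
  have hN1 : (0 : ℝ) < (N : ℝ) - 1 := by
    have : (2 : ℝ) ≤ N := by exact_mod_cast hN
    linarith
  have : popVarS N w - 2 * pcov N v w + pcov N v v
      = (∑ i, ((w i - popMeanS N w) - (v i - popMeanS N v)) ^ 2) / ((N : ℝ) - 1) := by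
    unfold popVarS pcov
    rw [mul_div_assoc', ← sub_div, ← add_div, Finset.mul_sum, ← Finset.sum_sub_distrib,
      ← Finset.sum_add_distrib]
    congr 1
    refine Finset.sum_congr rfl fun i _ => by ring
  rw [this]
  exact div_nonneg (Finset.sum_nonneg fun i _ => sq_nonneg _) hN1.le

lemma Sg_eq_pcov (N T : ℕ) (Y : Fin N → Date → Fin T → ℝ) (g : Date) (t t' : Fin T) :
    Sg N T Y g t t' = pcov N (fun i => Y i g t) (fun i => Y i g t') := rfl

/-- embedding of the pre-`gmin` periods -/
def pre {T gmin : ℕ} (hgT : gmin ≤ T) (k : Fin (gmin - 1)) : Fin T :=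
  ⟨k, by have := k.2; omega⟩

lemma Msel_mul {T gmin : ℕ} (hgT : gmin ≤ T) (S : Matrix (Fin T) (Fin T) ℝ) :
    Msel T gmin * S = S.submatrix (pre hgT) id := by
  ext k t
  simp only [Matrix.mul_apply, Msel, Matrix.of_apply, Matrix.submatrix_apply, id]
  rw [Finset.sum_eq_single (pre hgT k)]
  · simp [pre]
  · intro s _ hs
    have : (s : ℕ) ≠ k := fun h => hs (Fin.ext h)
    simp [this]
  · simp

lemma Msel_mul_mul {T gmin : ℕ} (hgT : gmin ≤ T) (S : Matrix (Fin T) (Fin T) ℝ) :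
    Msel T gmin * S * (Msel T gmin)ᵀ = S.submatrix (pre hgT) (pre hgT) := by
  rw [Msel_mul hgT]
  ext k l
  simp only [Matrix.mul_apply, Msel, Matrix.of_apply, Matrix.submatrix_apply, id,
    Matrix.transpose_apply]
  rw [Finset.sum_eq_single (pre hgT l)]
  · simp [pre]
  · intro s _ hs
    have : (s : ℕ) ≠ l := fun h => hs (Fin.ext h)
    simp [this]
  · simp

lemma pre_periodLT {T gmin : ℕ} (hgT : gmin ≤ T) (k : Fin (gmin - 1)) {g : Date}
    (hg : (gmin : Date) ≤ g) : periodLT (pre hgT k) g := by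
  unfold periodLT
  refine lt_of_lt_of_le ?_ hg
  have := k.2
  simp only [pre]
  exact_mod_cast (by omega : (k : ℕ) + 1 < gmin)

/-- **Lemmas 3 and A4, refined variance estimator.** Under Assumptions 1, 2, 3,
with `V*_{X̂}` positive definite, `A_{θ,g} = 0` for `g < g_min` and `M S*_{g_min} M'`
invertible, the refined estimator `σ̂**²` converges in probability to `σ*² + S*_{θ̃}` where
`0 ≤ S*_{θ̃} ≤ S*_θ`. -/
theorem statement14
    (T M : ℕ) (𝒢 : Finset Date) (N : ℕ → ℕ) (Ng : ℕ → Date → ℕ)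
    (Y : ∀ m, Fin (N m) → Date → Fin T → ℝ)
    (a : Fin T → Date → Date → ℝ) (b : Fin M → Fin T → Date → Date → ℝ)
    (p : Date → ℝ) (Sstar : Date → Matrix (Fin T) (Fin T) ℝ)
    (SstarCross : Date → Date → Matrix (Fin T) (Fin T) ℝ) (Sthetastar : ℝ) (gmin : ℕ)
    (hN2 : ∀ m, 2 ≤ N m) (hNtop : Tendsto N atTop atTop)
    (h𝒢ne : 𝒢.Nonempty) (h𝒢 : ∀ g ∈ 𝒢, (1 ≤ g ∧ g ≤ (T : Date)) ∨ g = ⊤)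
    (hNg : ∀ m, ∀ g ∈ 𝒢, 1 ≤ Ng m g) (hsum : ∀ m, ∑ g ∈ 𝒢, Ng m g = N m)
    (hNA : ∀ m (i : Fin (N m)) (t : Fin T), ∀ g ∈ 𝒢, ∀ g' ∈ 𝒢,
      periodLT t g → periodLT t g' → Y m i g t = Y m i g' t)
    (hb : ∀ (j : Fin M) (t : Fin T) (g g' : Date),
      b j t g g' ≠ 0 → periodLT t g ∧ periodLT t g')
    (hp : ∀ g ∈ 𝒢, 0 < p g ∧ p g < 1)
    (hpconv : ∀ g ∈ 𝒢, Tendsto (fun m => (Ng m g : ℝ) / (N m : ℝ)) atTop (𝓝 (p g)))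
    (hSconv : ∀ g ∈ 𝒢, ∀ t t' : Fin T,
      Tendsto (fun m => Sg (N m) T (Y m) g t t') atTop (𝓝 (Sstar g t t')))
    (hScross : ∀ g ∈ 𝒢, ∀ g' ∈ 𝒢, ∀ t t' : Fin T,
      Tendsto (fun m => Sgg (N m) T (Y m) g g' t t') atTop (𝓝 (SstarCross g g' t t')))
    (hSpd : ∀ g ∈ 𝒢, (Sstar g).PosDef)
    (hLind : ∀ ε > (0 : ℝ), ∀ᶠ m in atTop, ∀ (i : Fin (N m)), ∀ g ∈ 𝒢,
      (∑ t, (Y m i g t - popMeanS (N m) fun i' => Y m i' g t) ^ 2) / (N m : ℝ) < ε)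
    (hSthetaconv : Tendsto (fun m => Stheta (N m) T 𝒢 (Y m) a) atTop (𝓝 Sthetastar))
    (hVXpd : (VstarX T M 𝒢 b p Sstar).PosDef)
    (hgmem : (gmin : Date) ∈ 𝒢) (hg2 : 2 ≤ gmin) (hgT : gmin ≤ T)
    (hAzero : ∀ g ∈ 𝒢, g < (gmin : Date) → Atheta T 𝒢 a g = 0)
    (hMInv : IsUnit (Msel T gmin * Sstar (gmin : Date) * (Msel T gmin)ᵀ)) :
    let βstarg : Date → Fin (gmin - 1) → ℝ := fun g =>
      (Msel T gmin * Sstar g * (Msel T gmin)ᵀ)⁻¹.mulVec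
        ((Msel T gmin * Sstar g).mulVec (Atheta T 𝒢 a g))
    let sumβ : Fin (gmin - 1) → ℝ := ∑ g ∈ 𝒢.filter fun g => (gmin : Date) ≤ g, βstarg g
    let SthetaTildeStar : ℝ := Sthetastar -
      sumβ ⬝ᵥ ((Msel T gmin * Sstar (gmin : Date) * (Msel T gmin)ᵀ).mulVec sumβ)
    (∀ ε > (0 : ℝ),
      Tendsto (fun m => prob (N m) 𝒢 (Ng m) fun d =>
          ε < |sigmaSqRefined 𝒢 (Ng m) a b gmin (obs (Y m) d) d -
            (sigmaSqLim T M 𝒢 a b p Sstar Sthetastar + SthetaTildeStar)|)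
        atTop (𝓝 0)) ∧
    0 ≤ SthetaTildeStar ∧ SthetaTildeStar ≤ Sthetastar := by
  intro βstarg sumβ SthetaTildeStar
  have hp0 : ∀ g ∈ 𝒢, 0 < p g := fun g hg => (hp g hg).1
  set Q := Msel T gmin * Sstar (gmin : Date) * (Msel T gmin)ᵀ with hQ
  -- under no anticipation the pre-period blocks agree
  have hpre : ∀ g ∈ 𝒢, (gmin : Date) ≤ g → ∀ m (k : Fin (gmin - 1)),
      (fun i => Y m i g (pre hgT k)) = fun i => Y m i (gmin : Date) (pre hgT k) := by
    intro g hg hle m k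
    funext i
    exact hNA m i _ g hg _ hgmem (pre_periodLT hgT k hle) (pre_periodLT hgT k le_rfl)
  have hQg : ∀ g ∈ 𝒢, (gmin : Date) ≤ g → Msel T gmin * Sstar g * (Msel T gmin)ᵀ = Q := by
    intro g hg hle
    rw [hQ, Msel_mul_mul hgT, Msel_mul_mul hgT]
    ext k l
    simp only [Matrix.submatrix_apply]
    refine tendsto_nhds_unique (hSconv g hg _ _) ?_
    refine (hSconv _ hgmem (pre hgT k) (pre hgT l)).congr fun m => ?_
    rw [Sg_eq_pcov, Sg_eq_pcov, hpre g hg hle, hpre g hg hle]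
  have hQdet : IsUnit Q.det := (Matrix.isUnit_iff_isUnit_det _).1 hMInv
  have hQsum : Q.mulVec sumβ = ∑ g ∈ 𝒢.filter fun g => (gmin : Date) ≤ g,
      (Msel T gmin * Sstar g).mulVec (Atheta T 𝒢 a g) := by
    simp only [sumβ, Matrix.mulVec_sum]
    refine Finset.sum_congr rfl fun g hg => ?_
    obtain ⟨hg1, hg2⟩ := Finset.mem_filter.1 hg
    simp only [βstarg]
    rw [hQg g hg1 hg2, Matrix.mulVec_mulVec, Matrix.mul_nonsing_inv _ hQdet, Matrix.one_mulVec]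
  refine ⟨?_, ?_, ?_⟩
  · -- convergence in probability
    have hSh : ∀ g ∈ 𝒢, Tendsto (fun x : Σ m, Fin (N m) → 𝒢 =>
        Shat (Ng x.1) (obs (Y x.1) x.2) x.2 g) (pfil N 𝒢 Ng) (𝓝 (Sstar g)) := by
      intro g hg
      refine tendsto_pi_nhds.2 fun t => tendsto_pi_nhds.2 fun t' => ?_
      exact shat_tendsto hg Y hN2 hNtop (fun m => hNg m g hg) (hp0 g hg) (hpconv g hg)
        (hSconv g hg) (fun ε hε => (hLind ε hε).mono fun m h i => h i g hg) t t'
    have hr : ∀ g ∈ 𝒢, Tendsto (fun x : Σ m, Fin (N m) → 𝒢 => (N x.1 : ℝ) / (Ng x.1 g : ℝ))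
        (pfil N 𝒢 Ng) (𝓝 (p g)⁻¹) := by
      intro g hg
      refine (((hpconv g hg).inv₀ (hp0 g hg).ne').comp pfil_fst).congr fun x => ?_
      simp
    have h1 := tendsto_finsetSum 𝒢 fun g hg => (hr g hg).mul
      (tm_dot (tendsto_const_nhds (x := Atheta T 𝒢 a g))
        (tm_mulVec (hSh g hg) (tendsto_const_nhds (x := Atheta T 𝒢 a g))))
    have h2 := tendsto_finsetSum 𝒢 fun g hg => (hr g hg).smul
      (tm_mulVec (tm_mul (tendsto_const_nhds (x := A0 T M 𝒢 b g)) (hSh g hg))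
        (tendsto_const_nhds (x := Atheta T 𝒢 a g)))
    have h3 := tendsto_finsetSum 𝒢 fun g hg => (hr g hg).smul
      (tm_mul (tm_mul (tendsto_const_nhds (x := A0 T M 𝒢 b g)) (hSh g hg))
        (tendsto_const_nhds (x := (A0 T M 𝒢 b g)ᵀ)))
    have h4 := tm_inv h3 hVXpd.isUnit
    have hMSM : ∀ g ∈ 𝒢, Tendsto (fun x : Σ m, Fin (N m) → 𝒢 =>
        Msel T gmin * Shat (Ng x.1) (obs (Y x.1) x.2) x.2 g * (Msel T gmin)ᵀ)
        (pfil N 𝒢 Ng) (𝓝 (Msel T gmin * Sstar g * (Msel T gmin)ᵀ)) := fun g hg =>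
      tm_mul (tm_mul (tendsto_const_nhds (x := Msel T gmin)) (hSh g hg))
        (tendsto_const_nhds (x := (Msel T gmin)ᵀ))
    have h5 : Tendsto (fun x : Σ m, Fin (N m) → 𝒢 => ∑ g ∈ 𝒢.filter fun g => (gmin : Date) ≤ g,
        betaHatg (Ng x.1) a gmin (obs (Y x.1) x.2) x.2 g) (pfil N 𝒢 Ng) (𝓝 sumβ) := by
      refine tendsto_finsetSum _ fun g hg => ?_
      obtain ⟨hg1, hg2⟩ := Finset.mem_filter.1 hg
      refine tm_mulVec (tm_inv (hMSM g hg1) ?_)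
        (tm_mulVec (tm_mul (tendsto_const_nhds (x := Msel T gmin)) (hSh g hg1))
        (tendsto_const_nhds (x := Atheta T 𝒢 a g)))
      rw [hQg g hg1 hg2]
      exact hMInv
    have hF := (h1.sub (tm_dot h2 (tm_mulVec h4 h2))).sub
      (tm_dot h5 (tm_mulVec (hMSM _ hgmem) h5))
    have hlim : sigmaSqLim T M 𝒢 a b p Sstar Sthetastar + SthetaTildeStar
        = (∑ g ∈ 𝒢, (p g)⁻¹ * (Atheta T 𝒢 a g ⬝ᵥ (Sstar g).mulVec (Atheta T 𝒢 a g)))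
          - VstarXtheta T M 𝒢 a b p Sstar ⬝ᵥ
            (VstarX T M 𝒢 b p Sstar)⁻¹.mulVec (VstarXtheta T M 𝒢 a b p Sstar)
          - sumβ ⬝ᵥ (Q.mulVec sumβ) := by
      simp only [sigmaSqLim, VstarTheta, SthetaTildeStar]
      ring
    have hF' : Tendsto (fun x : Σ m, Fin (N m) → 𝒢 =>
        sigmaSqRefined 𝒢 (Ng x.1) a b gmin (obs (Y x.1) x.2) x.2) (pfil N 𝒢 Ng)
        (𝓝 (sigmaSqLim T M 𝒢 a b p Sstar Sthetastar + SthetaTildeStar)) := by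
      rw [hlim]
      exact hF
    intro ε hε
    have := (Metric.tendsto_nhds.1 hF') ε hε
    rw [pfil_eventually] at this
    refine squeeze_zero (fun m => prob_nonneg _) (fun m => prob_mono ?_) this
    intro d _ h
    rw [Real.dist_eq, not_lt]
    exact h.le
  · -- nonnegativity
    have hcov : ∀ m, pcov (N m) (fun i => ∑ k, sumβ k * Y m i (gmin : Date) (pre hgT k))
        (fun i => ∑ g ∈ 𝒢, Atheta T 𝒢 a g ⬝ᵥ Y m i g)
        = sumβ ⬝ᵥ ∑ g ∈ 𝒢.filter fun g => (gmin : Date) ≤ g,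
          (Msel T gmin * Sg (N m) T (Y m) g).mulVec (Atheta T 𝒢 a g) := by
      intro m
      rw [pcov_sum]
      simp only [dotProduct]
      refine Finset.sum_congr rfl fun k _ => ?_
      congr 1
      have e1 := pcov_sum_right 𝒢 (fun _ => 1) (fun g i => ∑ t, Atheta T 𝒢 a g t * Y m i g t)
        (fun i => Y m i (gmin : Date) (pre hgT k))
      simp only [one_mul] at e1
      rw [e1, Finset.sum_apply, Finset.sum_filter]
      refine Finset.sum_congr rfl fun g hg => ?_
      rw [pcov_sum_right]
      split_ifs with hle
      · rw [Msel_mul hgT]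
        simp only [Matrix.mulVec, dotProduct, Matrix.submatrix_apply, id]
        refine Finset.sum_congr rfl fun t _ => ?_
        rw [Sg_eq_pcov, hpre g hg hle, mul_comm]
      · rw [hAzero g hg (not_le.1 hle)]
        simp
    have hvar : ∀ m, pcov (N m) (fun i => ∑ k, sumβ k * Y m i (gmin : Date) (pre hgT k))
        (fun i => ∑ k, sumβ k * Y m i (gmin : Date) (pre hgT k))
        = sumβ ⬝ᵥ (Msel T gmin * Sg (N m) T (Y m) (gmin : Date) * (Msel T gmin)ᵀ).mulVec sumβ := by
      intro m
      rw [pcov_sum, Msel_mul_mul hgT]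
      simp only [dotProduct, Matrix.mulVec, Matrix.submatrix_apply]
      refine Finset.sum_congr rfl fun k _ => ?_
      congr 1
      rw [pcov_sum_right]
      refine Finset.sum_congr rfl fun l _ => ?_
      rw [Sg_eq_pcov, mul_comm]
    have hSm : ∀ g ∈ 𝒢, Tendsto (fun m => Sg (N m) T (Y m) g) atTop (𝓝 (Sstar g)) := fun g hg =>
      tendsto_pi_nhds.2 fun t => tendsto_pi_nhds.2 fun t' => hSconv g hg t t'
    have l1 := tm_dot (tendsto_const_nhds (x := sumβ))
      (tendsto_finsetSum (𝒢.filter fun g => (gmin : Date) ≤ g) fun g hg =>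
        tm_mulVec (tm_mul (tendsto_const_nhds (x := Msel T gmin))
          (hSm g (Finset.mem_filter.1 hg).1)) (tendsto_const_nhds (x := Atheta T 𝒢 a g)))
    have l2 := tm_dot (tendsto_const_nhds (x := sumβ))
      (tm_mulVec (tm_mul (tm_mul (tendsto_const_nhds (x := Msel T gmin)) (hSm _ hgmem))
        (tendsto_const_nhds (x := (Msel T gmin)ᵀ))) (tendsto_const_nhds (x := sumβ)))
    rw [← hQsum] at l1
    have l3 := (hSthetaconv.sub (l1.const_mul 2)).add l2
    have l4 := ge_of_tendsto' l3 (b := 0) ?_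
    · simp only [SthetaTildeStar]
      linarith
    · intro m
      have := pcov_sub_nonneg (hN2 m) (fun i => ∑ g ∈ 𝒢, Atheta T 𝒢 a g ⬝ᵥ Y m i g)
        (fun i => ∑ k, sumβ k * Y m i (gmin : Date) (pre hgT k))
      rw [hcov, hvar] at this
      exact this
  · -- upper bound
    have hpsd : Q.PosSemidef := by
      rw [hQ, Msel_mul_mul hgT]
      exact (hSpd _ hgmem).posSemidef.submatrix _
    have := hpsd.dotProduct_mulVec_nonneg sumβ
    simp only [star_trivial] at this
    simp only [SthetaTildeStar]
    linarith

end Staggered
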